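/- Sugiyama-type integral formula for complex zonal polynomials (Lemma 2): let n ≥ 1, let a be a real number with a > n−1, and let κ be a partition of k with at most n parts. Then ∫_{1>x₂>⋯>x_n>0} (∏_{i=2}^n x_i)^{a−n} · C_κ(1, x₂,…,x_n) · ∏_{i=2}^n (1−x_i)² · ∏_{2≤i<j≤n}(x_i−x_j)² dx₂⋯dx_n = (na+k)·(Γ_n(n)/π^{n²−n})·Γ_n(a,κ)·Γ_n(n)·C_κ(I_n)/Γ_n(a+n,κ), where C_κ(1,x₂,…,x_n) = χ_κ·s_κ(1,x₂,…,x_n). -/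

import Mathlib

open scoped BigOperators Real
open MeasureTheory

noncomputable section

/-- The set `P^k_n` of partitions of `k` with at most `n` parts, encoded as weakly
decreasing functions `Fin n → ℕ` summing to `k`. -/
def partitionsOf (n k : ℕ) : Finset (Fin n → ℕ) :=
  (Fintype.piFinset fun _ : Fin n => Finset.range (k + 1)).filter
    fun κ => (∀ i j : Fin n, i ≤ j → κ j ≤ κ i) ∧ ∑ i, κ i = k

/-- `χ_κ = k!·∏_{i<j}(κ_i−κ_j−i+j)/∏_i (κ_i+n−i)!` (0-indexed version). -/
def chi (n : ℕ) (κ : Fin n → ℕ) : ℝ :=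
  (Nat.factorial (∑ i, κ i) : ℝ)
    * (∏ i : Fin n, ∏ j : Fin n,
        if (i : ℕ) < (j : ℕ) then ((κ i : ℝ) - (κ j : ℝ) + (j : ℕ) - (i : ℕ)) else 1)
    / ∏ i : Fin n, (Nat.factorial (κ i + (n - 1 - (i : ℕ))) : ℝ)

/-- `S` is the family of Schur polynomials in `n` variables: for every partition `κ`
(with at most `n` parts), `det((x_i^{κ_j+n−j})) = S κ · ∏_{i<j}(x_i−x_j)`. -/
def IsSchur (n : ℕ) (S : (Fin n → ℕ) → MvPolynomial (Fin n) ℝ) : Prop :=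
  ∀ κ : Fin n → ℕ, (∀ i j : Fin n, i ≤ j → κ j ≤ κ i) →
    (Matrix.of fun i j : Fin n =>
        (MvPolynomial.X i : MvPolynomial (Fin n) ℝ) ^ (κ j + (n - 1 - (j : ℕ)))).det
      = S κ * ∏ i : Fin n, ∏ j : Fin n,
          if (i : ℕ) < (j : ℕ) then (MvPolynomial.X i - MvPolynomial.X j) else 1

/-- The one-row partition `(k, 0, …, 0)`. -/
def oneRow (n k : ℕ) : Fin n → ℕ := fun i => if (i : ℕ) = 0 then k else 0

/-- `δ/τ` is a horizontal strip: `δ_i ≥ τ_i ≥ δ_{i+1}` for all `i`. -/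
def IsHStrip {n : ℕ} (τ δ : Fin n → ℕ) : Prop :=
  (∀ i, τ i ≤ δ i) ∧ ∀ i j : Fin n, (i : ℕ) + 1 = (j : ℕ) → δ j ≤ τ i

instance {n : ℕ} (τ δ : Fin n → ℕ) : Decidable (IsHStrip τ δ) := by
  unfold IsHStrip; infer_instance

/-- The generalized (complex) Pochhammer symbol `(a)_κ = ∏_i (a−i+1)_{κ_i}` (0-indexed). -/
def pochP {n : ℕ} (a : ℝ) (κ : Fin n → ℕ) : ℝ :=
  ∏ i : Fin n, (ascPochhammer ℝ (κ i)).eval (a - (i : ℕ))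

/-- The complex multivariate gamma function `Γ_n(a, κ)`. -/
def cGammaP (n : ℕ) (a : ℝ) (κ : Fin n → ℕ) : ℝ :=
  Real.pi ^ (n * (n - 1) / 2) * ∏ i : Fin n, Real.Gamma (a + (κ i : ℝ) - (i : ℕ))

/-- `Γ_n(a) = Γ_n(a, 0)`. -/
def cGamma (n : ℕ) (a : ℝ) : ℝ := cGammaP n a fun _ => 0

/-- Pad a partition with at most `n` parts to one with at most `m` parts (`m ≥ n`). -/
def padP {n : ℕ} (m : ℕ) (κ : Fin n → ℕ) : Fin m → ℕ :=
  fun i => if h : (i : ℕ) < n then κ ⟨i, h⟩ else 0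

lemma aux_vdm {R : Type*} [CommRing R] (n : ℕ) (u : Fin n → R) :
    (Matrix.of fun i j : Fin n => u i ^ (n - 1 - (j : ℕ))).det
      = ∏ i : Fin n, ∏ j : Fin n, if (i : ℕ) < (j : ℕ) then u i - u j else 1 := by
  have h := Matrix.det_projVandermonde (fun _ : Fin n => (1 : R)) u
  have e : (Matrix.of fun i j : Fin n => u i ^ (n - 1 - (j : ℕ)))
      = Matrix.projVandermonde (fun _ : Fin n => (1 : R)) u := by
    ext i j
    simp only [Matrix.of_apply, Matrix.projVandermonde_apply, one_pow, one_mul, Fin.val_rev]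
    congr 1
    omega
  rw [e, h]
  refine Finset.prod_congr rfl fun i _ => ?_
  rw [← Finset.prod_filter]
  refine Finset.prod_congr ?_ fun j _ => by ring
  ext j
  simp

lemma aux_cauchy (n : ℕ) : ∀ (x y : Fin n → ℝ), (∀ i j, x i + y j ≠ 0) →
    (Matrix.of fun i j : Fin n => (x i + y j)⁻¹).det
      = (∏ i : Fin n, ∏ j : Fin n, if (i : ℕ) < (j : ℕ) then x i - x j else 1)
        * (∏ i : Fin n, ∏ j : Fin n, if (i : ℕ) < (j : ℕ) then y i - y j else 1)
        / ∏ i : Fin n, ∏ j : Fin n, (x i + y j) := by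
  induction n with
  | zero => intro x y _; simp
  | succ n ih =>
    intro x y h
    have key := Matrix.det_eq_of_forall_row_eq_smul_add_const
      (A := Matrix.of fun i j : Fin (n+1) => (x i + y j)⁻¹)
      (B := Matrix.of fun i j : Fin (n+1) => (x i + y j)⁻¹
          - (if i = 0 then 0 else (x 0 + y 0) / (x i + y 0)) * (x 0 + y j)⁻¹)
      (fun i => if i = 0 then 0 else (x 0 + y 0) / (x i + y 0)) 0 (by simp) (by
        intro i j; simp)
    rw [key, Matrix.det_succ_column_zero, Fin.sum_univ_succ]
    have hz : ∑ i : Fin n, (-1 : ℝ) ^ ((i.succ : Fin (n+1)) : ℕ) *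
        (Matrix.of fun i j : Fin (n+1) => (x i + y j)⁻¹
          - (if i = 0 then 0 else (x 0 + y 0) / (x i + y 0)) * (x 0 + y j)⁻¹) i.succ 0
        * (Matrix.submatrix (Matrix.of fun i j : Fin (n+1) => (x i + y j)⁻¹
          - (if i = 0 then 0 else (x 0 + y 0) / (x i + y 0)) * (x 0 + y j)⁻¹)
            i.succ.succAbove Fin.succ).det = 0 := by
      apply Finset.sum_eq_zero
      intro i _
      have : (Matrix.of fun i j : Fin (n+1) => (x i + y j)⁻¹
          - (if i = 0 then 0 else (x 0 + y 0) / (x i + y 0)) * (x 0 + y j)⁻¹) i.succ 0 = 0 := by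
        simp only [Matrix.of_apply, Fin.succ_ne_zero, if_false]
        have h1 := h i.succ 0
        have h2 := h 0 0
        field_simp
        simp
      rw [this]; simp
    rw [hz]
    have hsub : (Matrix.submatrix (Matrix.of fun i j : Fin (n+1) => (x i + y j)⁻¹
          - (if i = 0 then 0 else (x 0 + y 0) / (x i + y 0)) * (x 0 + y j)⁻¹)
            (Fin.succAbove 0) Fin.succ)
        = Matrix.of fun i j : Fin n => ((x 0 - x i.succ) / (x i.succ + y 0)) *
          (Matrix.of fun i j : Fin n => ((y 0 - y j.succ) / (x 0 + y j.succ)) *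
          (Matrix.of fun i j : Fin n => (x i.succ + y j.succ)⁻¹) i j) i j := by
      ext i j
      simp only [Matrix.submatrix_apply, Matrix.of_apply, Fin.zero_succAbove, Fin.succ_ne_zero,
        if_false]
      have h1 := h i.succ 0
      have h2 := h 0 j.succ
      have h3 := h i.succ j.succ
      field_simp
      ring
    rw [hsub, Matrix.det_mul_column, Matrix.det_mul_row,
      ih (fun i => x i.succ) (fun i => y i.succ) (fun i j => h _ _)]
    simp only [Fin.prod_univ_succ (n := n), Fin.val_zero, Fin.val_succ, if_false,
      Nat.succ_pos, if_true, not_lt_zero, Nat.add_lt_add_iff_right, Finset.prod_div_distrib,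
      Finset.prod_mul_distrib]
    simp only [Matrix.of_apply, if_true]
    have h00 := h 0 0
    have hA : ∏ i : Fin n, (x i.succ + y 0) ≠ 0 := Finset.prod_ne_zero_iff.2 fun i _ => h _ _
    have hB : ∏ i : Fin n, (x 0 + y i.succ) ≠ 0 := Finset.prod_ne_zero_iff.2 fun i _ => h _ _
    have hC : ∏ i : Fin n, ∏ j : Fin n, (x i.succ + y j.succ) ≠ 0 :=
      Finset.prod_ne_zero_iff.2 fun i _ => Finset.prod_ne_zero_iff.2 fun j _ => h _ _
    simp
    field_simp

lemma aux_cofsum (n : ℕ) (x y : Fin (n+1) → ℝ) (h : ∀ i j, x i + y j ≠ 0) :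
    ∑ j : Fin (n+1), ∑ l : Fin (n+1), (-1 : ℝ) ^ (j : ℕ) * (-1) ^ (l : ℕ) *
      (Matrix.of fun p q : Fin n => (x (j.succAbove p) + y (l.succAbove q))⁻¹).det
    = (∑ i, x i + ∑ i, y i) * (Matrix.of fun i j : Fin (n+1) => (x i + y j)⁻¹).det := by
  set M := Matrix.of fun i j : Fin (n+1) => (x i + y j)⁻¹ with hM
  have e : ∀ j l : Fin (n+1), (-1 : ℝ) ^ (j : ℕ) * (-1) ^ (l : ℕ) *
      (Matrix.of fun p q : Fin n => (x (j.succAbove p) + y (l.succAbove q))⁻¹).det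
      = x j * ((-1) ^ (j + l : ℕ) * M j l * (M.submatrix j.succAbove l.succAbove).det)
      + y l * ((-1) ^ (j + l : ℕ) * M j l * (M.submatrix j.succAbove l.succAbove).det) := by
    intro j l
    have : (M.submatrix j.succAbove l.succAbove)
       = (Matrix.of fun p q : Fin n => (x (j.succAbove p) + y (l.succAbove q))⁻¹) := rfl
    rw [this, ← add_mul]
    have hm : M j l = (x j + y l)⁻¹ := rfl
    rw [hm, pow_add]
    have := h j l
    field_simp
  simp_rw [e, Finset.sum_add_distrib]
  rw [add_mul]
  congr 1
  · rw [Finset.sum_mul]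
    refine Finset.sum_congr rfl fun j _ => ?_
    rw [← Finset.mul_sum, ← Matrix.det_succ_row]
  · rw [Finset.sum_comm, Finset.sum_mul]
    refine Finset.sum_congr rfl fun j _ => ?_
    rw [← Finset.mul_sum, ← Matrix.det_succ_column]

lemma aux_gamma (b : ℝ) (hb : 0 < b) (n : ℕ) :
    Real.Gamma (b + n) = (∏ l : Fin n, (b + ((n - 1 - (l : ℕ) : ℕ) : ℝ))) * Real.Gamma b := by
  have h1 : ∀ n : ℕ, Real.Gamma (b + n) = (∏ l ∈ Finset.range n, (b + (l : ℝ))) * Real.Gamma b := by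
    intro n
    induction n with
    | zero => simp
    | succ n ih =>
      rw [Finset.prod_range_succ]
      push_cast
      rw [← add_assoc, Real.Gamma_add_one (by positivity), ih]
      ring
  rw [h1, Fin.prod_univ_eq_prod_range (fun l => (b + ((n - 1 - l : ℕ) : ℝ))) n,
    Finset.prod_range_reflect (fun l => b + (l : ℝ)) n]

lemma aux_fact (N : ℕ) :
    (∏ i : Fin (N+1), ∏ j : Fin (N+1), if (i : ℕ) < (j : ℕ) then ((j : ℕ) : ℝ) - (i : ℕ) else 1)
      = ∏ i : Fin (N+1), Real.Gamma ((N : ℝ) + 1 - (i : ℕ)) := by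
  refine Finset.prod_congr rfl fun i _ => ?_
  rw [Fin.prod_univ_eq_prod_range (fun j => if (i : ℕ) < j then (j : ℝ) - (i : ℕ) else 1) (N+1)]
  have h : ∀ m i : ℕ, ∏ j ∈ Finset.range (m+1), (if i < j then (j : ℝ) - i else 1)
      = ((m - i).factorial : ℝ) := by
    intro m i
    induction m with
    | zero => simp
    | succ m ih =>
      rw [Finset.prod_range_succ, ih]
      split_ifs with hh
      · rw [Nat.succ_sub (by omega), Nat.factorial_succ]
        push_cast [Nat.cast_sub (show i ≤ m by omega)]
        ring
      · rw [Nat.sub_eq_zero_of_le (by omega), Nat.sub_eq_zero_of_le (by omega)]; simp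
  rw [h, ← Real.Gamma_nat_eq_factorial, Nat.cast_sub (by omega)]
  congr 1; ring

lemma aux_divprod (n : ℕ) (f : Fin n → Fin n → ℝ) (c : ℝ) :
    (∏ i : Fin n, ∏ j : Fin n, if (i : ℕ) < (j : ℕ) then f i j / c else 1)
    = (∏ i : Fin n, ∏ j : Fin n, if (i : ℕ) < (j : ℕ) then f i j else 1)
     / (∏ i : Fin n, ∏ j : Fin n, if (i : ℕ) < (j : ℕ) then c else 1) := by
  rw [← Finset.prod_div_distrib]
  refine Finset.prod_congr rfl fun i _ => ?_
  rw [← Finset.prod_div_distrib]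
  refine Finset.prod_congr rfl fun j _ => ?_
  split_ifs <;> simp

lemma aux_slope (p q : ℕ) :
    Filter.Tendsto (fun t : ℝ => (t ^ p - t ^ q) / (t - 1)) (nhdsWithin 1 {1}ᶜ)
      (nhds ((p : ℝ) - q)) := by
  have h : HasDerivAt (fun t : ℝ => t ^ p - t ^ q) ((p : ℝ) - q) 1 := by
    have := (hasDerivAt_pow p (1:ℝ)).fun_sub (hasDerivAt_pow q (1:ℝ))
    simpa using this
  rw [hasDerivAt_iff_tendsto_slope] at h
  refine h.congr fun t => ?_
  simp [slope_def_field]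

lemma aux_weyl (n : ℕ) (κ : Fin n → ℕ) (s : MvPolynomial (Fin n) ℝ)
    (h : (Matrix.of fun i j : Fin n =>
        (MvPolynomial.X i : MvPolynomial (Fin n) ℝ) ^ (κ j + (n - 1 - (j : ℕ)))).det
      = s * ∏ i : Fin n, ∏ j : Fin n,
          if (i : ℕ) < (j : ℕ) then (MvPolynomial.X i - MvPolynomial.X j) else 1) :
    (∏ i : Fin n, ∏ j : Fin n, if (i : ℕ) < (j : ℕ) then
      ((κ i + (n - 1 - (i : ℕ)) : ℕ) : ℝ) - ((κ j + (n - 1 - (j : ℕ)) : ℕ) : ℝ) else 1)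
    = MvPolynomial.eval (fun _ => (1 : ℝ)) s *
      ∏ i : Fin n, ∏ j : Fin n, if (i : ℕ) < (j : ℕ) then
        ((n - 1 - (i : ℕ) : ℕ) : ℝ) - ((n - 1 - (j : ℕ) : ℕ) : ℝ) else 1 := by
  have h1 : Filter.Tendsto (fun t : ℝ => ∏ i : Fin n, ∏ j : Fin n, if (i : ℕ) < (j : ℕ) then
      (t ^ (κ i + (n - 1 - (i : ℕ))) - t ^ (κ j + (n - 1 - (j : ℕ)))) / (t - 1) else 1)
      (nhdsWithin 1 {1}ᶜ) (nhds (∏ i : Fin n, ∏ j : Fin n, if (i : ℕ) < (j : ℕ) then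
      ((κ i + (n - 1 - (i : ℕ)) : ℕ) : ℝ) - ((κ j + (n - 1 - (j : ℕ)) : ℕ) : ℝ) else 1)) := by
    refine tendsto_finsetProd _ fun i _ => tendsto_finsetProd _ fun j _ => ?_
    split_ifs
    · exact aux_slope _ _
    · exact tendsto_const_nhds
  have h2 : Filter.Tendsto (fun t : ℝ => MvPolynomial.eval (fun i : Fin n => t ^ (n - 1 - (i : ℕ))) s
      * ∏ i : Fin n, ∏ j : Fin n, if (i : ℕ) < (j : ℕ) then
      (t ^ (n - 1 - (i : ℕ)) - t ^ (n - 1 - (j : ℕ))) / (t - 1) else 1)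
      (nhdsWithin 1 {1}ᶜ) (nhds (MvPolynomial.eval (fun _ => (1 : ℝ)) s *
      ∏ i : Fin n, ∏ j : Fin n, if (i : ℕ) < (j : ℕ) then
        ((n - 1 - (i : ℕ) : ℕ) : ℝ) - ((n - 1 - (j : ℕ) : ℕ) : ℝ) else 1)) := by
    refine Filter.Tendsto.mul ?_ ?_
    · have hc : Continuous (fun t : ℝ => MvPolynomial.eval (fun i : Fin n => t ^ (n - 1 - (i : ℕ))) s) :=
        (MvPolynomial.continuous_eval s).comp (by fun_prop)
      have := (hc.tendsto 1).mono_left (nhdsWithin_le_nhds (s := {1}ᶜ))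
      simpa using this
    · refine tendsto_finsetProd _ fun i _ => tendsto_finsetProd _ fun j _ => ?_
      split_ifs
      · exact aux_slope _ _
      · exact tendsto_const_nhds
  refine tendsto_nhds_unique h1 (h2.congr fun t => ?_)
  rw [aux_divprod n (fun i j => t ^ (κ i + (n - 1 - (i : ℕ))) - t ^ (κ j + (n - 1 - (j : ℕ)))),
    aux_divprod n (fun i j => t ^ (n - 1 - (i : ℕ)) - t ^ (n - 1 - (j : ℕ))), ← mul_div_assoc]
  congr 1
  have h3 := congrArg (MvPolynomial.eval (fun i : Fin n => t ^ (n - 1 - (i : ℕ)))) h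
  rw [map_mul, RingHom.map_det] at h3
  simp only [map_prod, apply_ite (MvPolynomial.eval (fun i : Fin n => t ^ (n - 1 - (i : ℕ)))),
    map_sub, map_one, MvPolynomial.eval_X] at h3
  rw [← h3, ← aux_vdm, ← Matrix.det_transpose]
  congr 1
  ext i j
  simp [← pow_mul, mul_comm]

lemma aux_noninj (N : ℕ) : ∀ᵐ y : Fin N → ℝ, Function.Injective y := by
  have h : ∀ i j : Fin N, i ≠ j → ∀ᵐ y : Fin N → ℝ, y i ≠ y j := by
    intro i j hij
    have := Measure.addHaar_submodule (volume : Measure (Fin N → ℝ))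
      (LinearMap.ker ((LinearMap.proj i : (Fin N → ℝ) →ₗ[ℝ] ℝ) - LinearMap.proj j)) (by
        intro ht
        have : (Pi.single i 1 : Fin N → ℝ) ∈
          (LinearMap.ker ((LinearMap.proj i : (Fin N → ℝ) →ₗ[ℝ] ℝ) - LinearMap.proj j)) := by
          rw [ht]; trivial
        simp [hij.symm] at this)
    rw [ae_iff]
    convert this using 2
    ext y
    simp [sub_eq_zero]
  have h2 : ∀ᵐ y : Fin N → ℝ, ∀ i j : Fin N, i ≠ j → y i ≠ y j := by
    rw [ae_all_iff]; intro i
    rw [ae_all_iff]; intro j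
    by_cases hij : i = j
    · simp [hij]
    · filter_upwards [h i j hij] with y hy _ using hy
  filter_upwards [h2] with y hy i j hij
  by_contra hne
  exact hy i j hne hij

lemma aux_meas (N : ℕ) : MeasurableSet {y : Fin N → ℝ | StrictAnti y} := by
  have : {y : Fin N → ℝ | StrictAnti y} = ⋂ i, ⋂ j, ⋂ (_ : i < j), {y | y j < y i} := by
    ext y; simp [StrictAnti]
  rw [this]
  refine MeasurableSet.iInter fun i => MeasurableSet.iInter fun j => MeasurableSet.iInter fun _ => ?_
  exact measurableSet_lt (by fun_prop) (by fun_prop)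

lemma aux_sum_regions (N : ℕ) (F : (Fin N → ℝ) → ℝ) (hF : Integrable F) :
    ∫ y, F y = ∑ σ : Equiv.Perm (Fin N),
      ∫ y in {y : Fin N → ℝ | StrictAnti y}, F (y ∘ σ) := by
  have hpre : ∀ σ : Equiv.Perm (Fin N), MeasurePreserving
      (fun y : Fin N → ℝ => y ∘ σ) volume volume ∧
      MeasurableEmbedding (fun y : Fin N → ℝ => y ∘ σ) := by
    intro σ
    have h := volume_measurePreserving_piCongrLeft (fun _ : Fin N => ℝ) σ.symm
    have e : (MeasurableEquiv.piCongrLeft (fun _ : Fin N => ℝ) σ.symm : (Fin N → ℝ) → (Fin N → ℝ))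
        = fun y => y ∘ σ := by
      ext y i
      simp [MeasurableEquiv.piCongrLeft, Equiv.piCongrLeft, Equiv.piCongrLeft']
    rw [← e]
    exact ⟨h, MeasurableEquiv.measurableEmbedding _⟩
  have hE : ∀ σ : Equiv.Perm (Fin N), MeasurableSet {y : Fin N → ℝ | StrictAnti (y ∘ σ)} :=
    fun σ => (hpre σ).1.measurable (aux_meas N)
  have hU : (⋃ σ : Equiv.Perm (Fin N), {y : Fin N → ℝ | StrictAnti (y ∘ σ)}) =ᵐ[volume] Set.univ := by
    rw [ae_eq_univ, ← mem_ae_iff]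
    filter_upwards [aux_noninj N] with y hy
    simp only [Set.mem_iUnion, Set.mem_ofPred_eq]
    refine ⟨Fin.revPerm.trans (Tuple.sort y), ?_⟩
    have hm := Tuple.monotone_sort y
    have hs : StrictMono (y ∘ Tuple.sort y) :=
      hm.strictMono_of_injective (hy.comp (Tuple.sort y).injective)
    intro i j hij
    exact hs (Fin.rev_lt_rev.2 hij)
  rw [← setIntegral_univ, ← setIntegral_congr_set hU, integral_iUnion_fintype hE]
  · rw [← Equiv.sum_comp (Equiv.inv (Equiv.Perm (Fin N)))]
    refine Finset.sum_congr rfl fun σ _ => ?_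
    have h := (hpre σ).1.setIntegral_preimage_emb (hpre σ).2 F
      {y : Fin N → ℝ | StrictAnti (y ∘ (σ⁻¹ : Equiv.Perm (Fin N)))}
    simp only [Equiv.inv_apply]
    rw [← h]
    congr 2
    ext y
    simp [Function.comp_assoc]
  · intro σ τ hne
    rw [Function.onFun, Set.disjoint_left]
    intro y h1 h2
    apply hne
    simp only [Set.mem_ofPred_eq] at h1 h2
    have h3 := Tuple.unique_antitone h1.antitone h2.antitone
    have hy : Function.Injective y := by
      have := h1.injective
      rwa [Equiv.injective_comp] at this
    ext i
    exact congrArg _ (hy (congrFun h3 i))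
  · intro σ; exact hF.integrableOn

lemma aux_intdet (N : ℕ) (f g : Fin N → ℝ → ℝ) (h : ∀ i j, Integrable (fun x => f i x * g j x)) :
    Integrable (fun y : Fin N → ℝ => (∏ i, f i (y i)) * (Matrix.of fun i j => g j (y i)).det) ∧
    ∫ y : Fin N → ℝ, (∏ i, f i (y i)) * (Matrix.of fun i j => g j (y i)).det
      = (Matrix.of fun i j => ∫ x, f i x * g j x).det := by
  have e : ∀ y : Fin N → ℝ, (∏ i, f i (y i)) * (Matrix.of fun i j => g j (y i)).det
      = ∑ τ : Equiv.Perm (Fin N), ((Equiv.Perm.sign τ : ℤ) : ℝ) *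
        ∏ i, (f i (y i) * g (τ i) (y i)) := by
    intro y
    rw [← Matrix.det_transpose, Matrix.det_apply', Finset.mul_sum]
    refine Finset.sum_congr rfl fun τ _ => ?_
    simp only [Matrix.transpose_apply, Matrix.of_apply, Finset.prod_mul_distrib]
    ring
  have hi : ∀ τ : Equiv.Perm (Fin N), Integrable (fun y : Fin N → ℝ =>
      ((Equiv.Perm.sign τ : ℤ) : ℝ) * ∏ i, (f i (y i) * g (τ i) (y i))) := by
    intro τ
    exact (Integrable.fintype_prod (f := fun i x => f i x * g (τ i) x)
      (fun i => h i (τ i))).const_mul _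
  simp_rw [e]
  refine ⟨integrable_finsetSum _ fun τ _ => hi τ, ?_⟩
  rw [integral_finsetSum _ fun τ _ => hi τ, ← Matrix.det_transpose, Matrix.det_apply']
  refine Finset.sum_congr rfl fun τ _ => ?_
  rw [integral_const_mul,
    integral_fintype_prod_volume_eq_prod (fun i x => f i x * g (τ i) x)]
  rfl

lemma aux_andreief (N : ℕ) (f g : Fin N → ℝ → ℝ)
    (h : ∀ i j, Integrable (fun x => f i x * g j x)) :
    IntegrableOn (fun y : Fin N → ℝ => (Matrix.of fun i j => f j (y i)).det *
      (Matrix.of fun i j => g j (y i)).det) {y : Fin N → ℝ | StrictAnti y} ∧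
    ∫ y in {y : Fin N → ℝ | StrictAnti y}, (Matrix.of fun i j => f j (y i)).det *
      (Matrix.of fun i j => g j (y i)).det
      = (Matrix.of fun i j => ∫ x, f i x * g j x).det := by
  have e : ∀ y : Fin N → ℝ, (Matrix.of fun i j => f j (y i)).det *
      (Matrix.of fun i j => g j (y i)).det = ∑ σ : Equiv.Perm (Fin N),
        ((Equiv.Perm.sign σ : ℤ) : ℝ) * ((∏ i, f (σ i) (y i)) * (Matrix.of fun i j => g j (y i)).det) := by
    intro y
    rw [← Matrix.det_transpose, Matrix.det_apply', Finset.sum_mul]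
    refine Finset.sum_congr rfl fun τ _ => ?_
    simp only [Matrix.transpose_apply, Matrix.of_apply]
    ring
  have hi : ∀ σ : Equiv.Perm (Fin N), IntegrableOn (fun y : Fin N → ℝ =>
      ((Equiv.Perm.sign σ : ℤ) : ℝ) * ((∏ i, f (σ i) (y i)) * (Matrix.of fun i j => g j (y i)).det))
        {y : Fin N → ℝ | StrictAnti y} := fun σ =>
    ((aux_intdet N (fun i => f (σ i)) g (fun i j => h _ _)).1.const_mul _).integrableOn
  simp_rw [e]
  refine ⟨integrable_finsetSum _ fun σ _ => hi σ, ?_⟩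
  rw [integral_finsetSum _ fun σ _ => hi σ]
  obtain ⟨h1, h2⟩ := aux_intdet N f g h
  rw [← h2, aux_sum_regions N _ h1, ← Equiv.sum_comp (Equiv.inv (Equiv.Perm (Fin N)))]
  refine Finset.sum_congr rfl fun σ _ => ?_
  congr 1
  ext y
  have p1 : ∏ i, f i ((y ∘ σ) i) = ∏ i, f ((σ⁻¹ : Equiv.Perm (Fin N)) i) (y i) := by
    rw [← Equiv.prod_comp σ (fun i => f ((σ⁻¹ : Equiv.Perm (Fin N)) i) (y i))]
    simp
  have p2 : (Matrix.of fun i j => g j ((y ∘ σ) i)).det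
      = ((Equiv.Perm.sign σ : ℤ) : ℝ) * (Matrix.of fun i j => g j (y i)).det := by
    rw [← Matrix.det_permute]
    rfl
  rw [p1, p2]
  simp only [Equiv.inv_apply, Equiv.Perm.sign_inv]
  ring

lemma aux_onevar (c : ℝ) (p q : ℕ) (h : 0 < c + 1 + p + q) :
    Integrable (fun x : ℝ => (Set.Ioo (0:ℝ) 1).indicator (fun x => x ^ c * x ^ p) x * x ^ q) ∧
    ∫ x : ℝ, (Set.Ioo (0:ℝ) 1).indicator (fun x => x ^ c * x ^ p) x * x ^ q
      = (c + 1 + p + q)⁻¹ := by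
  have e : (fun x : ℝ => (Set.Ioo (0:ℝ) 1).indicator (fun x => x ^ c * x ^ p) x * x ^ q)
      = (Set.Ioo (0:ℝ) 1).indicator (fun x => x ^ (c + p + q)) := by
    ext x
    by_cases hx : x ∈ Set.Ioo (0:ℝ) 1
    · rw [Set.indicator_of_mem hx, Set.indicator_of_mem hx, Real.rpow_add hx.1, Real.rpow_add hx.1,
        Real.rpow_natCast, Real.rpow_natCast]
    · rw [Set.indicator_of_notMem hx, Set.indicator_of_notMem hx, zero_mul]
  rw [e, integrable_indicator_iff measurableSet_Ioo, integral_indicator measurableSet_Ioo]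
  constructor
  · rw [← intervalIntegrable_iff_integrableOn_Ioo_of_le zero_le_one]
    exact intervalIntegral.intervalIntegrable_rpow' (by linarith)
  · rw [← integral_Ioc_eq_integral_Ioo, ← intervalIntegral.integral_of_le zero_le_one,
      integral_rpow (Or.inl (by linarith)), Real.one_rpow, Real.zero_rpow (by linarith)]
    rw [sub_zero, one_div]
    congr 1; ring

lemma aux_cons (N : ℕ) (lam : Fin (N+1) → ℕ) (y : Fin N → ℝ) :
    (Matrix.of fun i j : Fin (N+1) => ((Fin.cons 1 y : Fin (N+1) → ℝ) i) ^ lam j).det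
     = ∑ j : Fin (N+1), (-1 : ℝ) ^ (j : ℕ) *
      (Matrix.of fun p q : Fin N => y p ^ lam (j.succAbove q)).det := by
  rw [Matrix.det_succ_row_zero]
  refine Finset.sum_congr rfl fun j _ => ?_
  simp only [Matrix.of_apply, Fin.cons_zero, one_pow, mul_one]
  congr 2

lemma aux_integral (N : ℕ) (c : ℝ) (lam mu : Fin (N+1) → ℕ)
    (h : ∀ i j, 0 < c + 1 + lam i + mu j) :
    ∫ y in {y : Fin N → ℝ | (∀ i, 0 < y i ∧ y i < 1) ∧ StrictAnti y},
      (∏ i, y i) ^ c *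
        ((Matrix.of fun i j : Fin (N+1) => ((Fin.cons 1 y : Fin (N+1) → ℝ) i) ^ lam j).det
        * (Matrix.of fun i j : Fin (N+1) => ((Fin.cons 1 y : Fin (N+1) → ℝ) i) ^ mu j).det)
    = (∑ i, (c + 1 + lam i) + ∑ i, (mu i : ℝ)) *
      (Matrix.of fun i j : Fin (N+1) => (c + 1 + lam i + mu j)⁻¹).det := by
  set D := {y : Fin N → ℝ | StrictAnti y} with hD
  set E := {y : Fin N → ℝ | (∀ i, 0 < y i ∧ y i < 1) ∧ StrictAnti y} with hE
  let f : Fin (N+1) → ℝ → ℝ := fun j => (Set.Ioo (0:ℝ) 1).indicator (fun x => x ^ c * x ^ lam j)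
  let g : Fin (N+1) → ℝ → ℝ := fun j x => x ^ mu j
  have hEm : MeasurableSet E := by
    have : E = (Set.univ.pi fun _ => Set.Ioo (0:ℝ) 1) ∩ D := by
      ext y; simp [hE, hD]
    rw [this]
    exact (MeasurableSet.univ_pi fun _ => measurableSet_Ioo).inter (aux_meas N)
  have hA := fun j l : Fin (N+1) => aux_andreief N (fun p => f (j.succAbove p))
    (fun p => g (l.succAbove p)) (fun p q => (aux_onevar c _ _ (h _ _)).1)
  have hED : E ⊆ D := fun y hy => hy.2
  rw [setIntegral_congr_fun (g := fun y => ∑ j : Fin (N+1), ∑ l : Fin (N+1),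
    (-1 : ℝ) ^ (j : ℕ) * (-1) ^ (l : ℕ) *
      ((Matrix.of fun p q : Fin N => f (j.succAbove q) (y p)).det *
       (Matrix.of fun p q : Fin N => g (l.succAbove q) (y p)).det)) hEm]
  · rw [← setIntegral_eq_of_subset_of_forall_sdiff_eq_zero (aux_meas N) hED]
    · rw [integral_finsetSum _ fun j _ => integrable_finsetSum _ fun l _ => (hA j l).1.const_mul _]
      rw [← aux_cofsum N (fun i => c + 1 + lam i) (fun i => (mu i : ℝ)) (fun i j => (h i j).ne')]
      refine Finset.sum_congr rfl fun j _ => ?_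
      rw [integral_finsetSum _ fun l _ => (hA j l).1.const_mul _]
      refine Finset.sum_congr rfl fun l _ => ?_
      rw [integral_const_mul, (hA j l).2]
      congr 2
      ext p q
      exact (aux_onevar c _ _ (h _ _)).2
    · intro y hy
      have : ∃ i, y i ∉ Set.Ioo (0:ℝ) 1 := by
        by_contra hcon
        push Not at hcon
        exact hy.2 ⟨hcon, hy.1⟩
      obtain ⟨i, hi⟩ := this
      refine Finset.sum_eq_zero fun j _ => Finset.sum_eq_zero fun l _ => ?_
      rw [Matrix.det_eq_zero_of_row_eq_zero i]
      · simp
      · intro q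
        exact Set.indicator_of_notMem hi (fun x : ℝ => x ^ c * x ^ lam (j.succAbove q))
  · intro y hy
    simp only
    rw [aux_cons, aux_cons, Finset.sum_mul_sum, Finset.mul_sum]
    refine Finset.sum_congr rfl fun j _ => ?_
    rw [Finset.mul_sum]
    refine Finset.sum_congr rfl fun l _ => ?_
    have hf : (Matrix.of fun p q : Fin N => f (j.succAbove q) (y p)).det
        = (∏ i, y i) ^ c * (Matrix.of fun p q : Fin N => y p ^ lam (j.succAbove q)).det := by
      have : (Matrix.of fun p q : Fin N => f (j.succAbove q) (y p))
        = Matrix.of fun p q : Fin N => (y p ^ c) *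
          (Matrix.of fun p q : Fin N => y p ^ lam (j.succAbove q)) p q := by
        ext p q
        exact Set.indicator_of_mem (show y p ∈ Set.Ioo (0:ℝ) 1 from hy.1 p)
          (fun x : ℝ => x ^ c * x ^ lam (j.succAbove q))
      rw [this, Matrix.det_mul_column, Real.finsetProd_rpow _ _ (fun i _ => (hy.1 i).1.le)]
    rw [hf]
    ring

theorem sugiyama_integral_complex_zonal
    (N : ℕ) (a : ℝ) (ha : (N : ℝ) < a) (k : ℕ)
    (κ : Fin (N + 1) → ℕ) (hκ : κ ∈ partitionsOf (N + 1) k)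
    (S : (Fin (N + 1) → ℕ) → MvPolynomial (Fin (N + 1)) ℝ) (hS : IsSchur (N + 1) S) :
    ∫ y in {y : Fin N → ℝ | (∀ i, 0 < y i ∧ y i < 1) ∧ StrictAnti y},
        ((∏ i, y i) ^ (a - (N + 1 : ℝ)))
          * (chi (N + 1) κ * MvPolynomial.eval (Fin.cons 1 y) (S κ))
          * (∏ i, (1 - y i) ^ 2)
          * (∏ i : Fin N, ∏ j : Fin N, if (i : ℕ) < (j : ℕ) then (y i - y j) ^ 2 else 1)
      = ((N + 1 : ℝ) * a + k)
          * (cGamma (N + 1) (N + 1) / π ^ ((N + 1) ^ 2 - (N + 1)))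
          * cGammaP (N + 1) a κ * cGamma (N + 1) (N + 1)
          * (chi (N + 1) κ * MvPolynomial.eval (fun _ => (1 : ℝ)) (S κ))
          / cGammaP (N + 1) (a + (N + 1)) κ := by
  simp only [partitionsOf, Finset.mem_filter] at hκ
  obtain ⟨-, hanti, hk⟩ := hκ
  have hs := hS κ hanti
  have hW := aux_weyl (N+1) κ (S κ) hs
  set lam : Fin (N+1) → ℕ := fun j => κ j + (N + 1 - 1 - (j : ℕ)) with hlam
  set mu : Fin (N+1) → ℕ := fun j => (N + 1 - 1 - (j : ℕ)) with hmu
  have hmuc : ∀ i, (mu i : ℝ) = N - (i : ℕ) := by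
    intro i
    simp only [hmu, Nat.add_sub_cancel]
    rw [Nat.cast_sub (by omega)]
  have hlamc : ∀ i, (lam i : ℝ) = κ i + (N - (i : ℕ)) := by
    intro i
    rw [← hmuc]; simp only [hlam, hmu]; push_cast; rfl
  have hb : ∀ i, a - (N + 1 : ℝ) + 1 + lam i = a + κ i - (i : ℕ) := by
    intro i; rw [hlamc]; ring
  have hbpos : ∀ i : Fin (N+1), 0 < a + (κ i : ℝ) - (i : ℕ) := by
    intro i
    have h1 : ((i : ℕ) : ℝ) ≤ N := by exact_mod_cast (by omega : (i : ℕ) ≤ N)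
    have h2 : (0:ℝ) ≤ κ i := by positivity
    linarith
  have hpos : ∀ i j, 0 < a - (N + 1 : ℝ) + 1 + lam i + mu j := by
    intro i j; rw [hb]
    have := hbpos i
    positivity
  have hint : ∀ y : Fin N → ℝ,
      ((∏ i, y i) ^ (a - (N + 1 : ℝ)))
          * (chi (N + 1) κ * MvPolynomial.eval (Fin.cons 1 y) (S κ))
          * (∏ i, (1 - y i) ^ 2)
          * (∏ i : Fin N, ∏ j : Fin N, if (i : ℕ) < (j : ℕ) then (y i - y j) ^ 2 else 1)
      = chi (N + 1) κ * ((∏ i, y i) ^ (a - (N + 1 : ℝ)) *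
        ((Matrix.of fun i j : Fin (N+1) => ((Fin.cons 1 y : Fin (N+1) → ℝ) i) ^ lam j).det
        * (Matrix.of fun i j : Fin (N+1) => ((Fin.cons 1 y : Fin (N+1) → ℝ) i) ^ mu j).det)) := by
    intro y
    have h3 := congrArg (MvPolynomial.eval (Fin.cons 1 y : Fin (N+1) → ℝ)) hs
    rw [map_mul, RingHom.map_det] at h3
    simp only [map_prod, apply_ite (MvPolynomial.eval (Fin.cons 1 y : Fin (N+1) → ℝ)),
      map_sub, map_one, MvPolynomial.eval_X] at h3
    have h4 : (Matrix.of fun i j : Fin (N+1) => ((Fin.cons 1 y : Fin (N+1) → ℝ) i) ^ lam j)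
      = (MvPolynomial.eval (Fin.cons 1 y : Fin (N+1) → ℝ)).mapMatrix (Matrix.of fun i j : Fin (N+1) =>
        (MvPolynomial.X i : MvPolynomial (Fin (N+1)) ℝ) ^ (lam j)) := by
      ext i j; simp
    have h5 := aux_vdm (N+1) (Fin.cons 1 y : Fin (N+1) → ℝ)
    have h6 : (∏ i : Fin (N+1), ∏ j : Fin (N+1), if (i : ℕ) < (j : ℕ) then
        (Fin.cons 1 y : Fin (N+1) → ℝ) i - (Fin.cons 1 y : Fin (N+1) → ℝ) j else 1)
        = (∏ i, (1 - y i)) * ∏ i : Fin N, ∏ j : Fin N, if (i : ℕ) < (j : ℕ) then (y i - y j) else 1 := by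
      simp [Fin.prod_univ_succ (n := N)]
    have h7 : (∏ i : Fin N, ∏ j : Fin N, if (i : ℕ) < (j : ℕ) then (y i - y j) ^ 2 else 1)
        = (∏ i : Fin N, ∏ j : Fin N, if (i : ℕ) < (j : ℕ) then (y i - y j) else 1) ^ 2 := by
      rw [← Finset.prod_pow]
      refine Finset.prod_congr rfl fun i _ => ?_
      rw [← Finset.prod_pow]
      refine Finset.prod_congr rfl fun j _ => ?_
      split_ifs <;> simp
    rw [h4, h3, h5, h6, h7, Finset.prod_pow]
    ring
  simp_rw [hint]
  rw [integral_const_mul, aux_integral N _ lam mu hpos,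
    aux_cauchy (N+1) (fun i => a - (N + 1 : ℝ) + 1 + lam i) (fun i => (mu i : ℝ))
      (fun i j => (hpos i j).ne')]
  have hsum : ∑ i, (a - (N + 1 : ℝ) + 1 + lam i) + ∑ i, (mu i : ℝ) = (N + 1 : ℝ) * a + k := by
    rw [← Finset.sum_add_distrib]
    have : ∀ i ∈ (Finset.univ : Finset (Fin (N+1))), a - (N + 1 : ℝ) + 1 + lam i + mu i
        = a + κ i + (((mu i : ℝ)) - (i : ℕ)) := by
      intro i _; rw [hb]; ring
    have h0 : ∑ i : Fin (N+1), ((mu i : ℝ) - (i : ℕ)) = 0 := by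
      rw [Finset.sum_sub_distrib, sub_eq_zero]
      rw [← Equiv.sum_comp Fin.revPerm]
      refine Finset.sum_congr rfl fun i _ => ?_
      rw [hmuc, Fin.revPerm_apply, Fin.val_rev, Nat.cast_sub (by omega)]
      push_cast; ring
    rw [Finset.sum_congr rfl this, Finset.sum_add_distrib, h0, Finset.sum_add_distrib, ← hk]
    simp
  rw [hsum]
  have hP : (∏ i : Fin (N+1), ∏ j : Fin (N+1), if (i : ℕ) < (j : ℕ) then
      (mu i : ℝ) - (mu j : ℝ) else 1) = ∏ i : Fin (N+1), Real.Gamma ((N : ℝ) + 1 - (i : ℕ)) := by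
    rw [← aux_fact]
    refine Finset.prod_congr rfl fun i _ => Finset.prod_congr rfl fun j _ => ?_
    rw [hmuc, hmuc]
    congr 1; ring
  have hW2 : (∏ i : Fin (N+1), ∏ j : Fin (N+1), if (i : ℕ) < (j : ℕ) then
      (a - (N + 1 : ℝ) + 1 + lam i) - (a - (N + 1 : ℝ) + 1 + lam j) else 1)
      = MvPolynomial.eval (fun _ => (1 : ℝ)) (S κ) *
        ∏ i : Fin (N+1), Real.Gamma ((N : ℝ) + 1 - (i : ℕ)) := by
    rw [← hP]
    refine Eq.trans ?_ hW
    refine Finset.prod_congr rfl fun i _ => Finset.prod_congr rfl fun j _ => ?_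
    congr 1
    rw [add_sub_add_left_eq_sub]
  rw [hW2, hP]
  have hG : ∏ i : Fin (N+1), Real.Gamma (a + (N + 1) + (κ i : ℝ) - (i : ℕ))
      = (∏ i : Fin (N+1), ∏ j : Fin (N+1), (a - (N + 1 : ℝ) + 1 + lam i + mu j)) *
        ∏ i : Fin (N+1), Real.Gamma (a + (κ i : ℝ) - (i : ℕ)) := by
    rw [← Finset.prod_mul_distrib]
    refine Finset.prod_congr rfl fun i _ => ?_
    have := aux_gamma _ (hbpos i) (N+1)
    rw [hb]
    rw [show a + (N + 1) + (κ i : ℝ) - (i : ℕ) = a + (κ i : ℝ) - (i : ℕ) + ((N + 1 : ℕ) : ℝ) by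
      push_cast; ring, this]
  have hpi : π ^ ((N + 1) ^ 2 - (N + 1)) = (π ^ ((N + 1) * (N + 1 - 1) / 2)) ^ 2 := by
    rw [← pow_mul]
    congr 1
    have h2 : (N + 1) * (N + 1 - 1) / 2 * 2 = (N + 1) * (N + 1 - 1) := by
      apply Nat.div_mul_cancel
      rw [Nat.add_sub_cancel, mul_comm]
      exact (Nat.even_mul_succ_self N).two_dvd
    rw [h2, Nat.mul_sub, mul_one, sq]
  have hA : ∏ i : Fin (N+1), ∏ j : Fin (N+1), (a - (N + 1 : ℝ) + 1 + lam i + mu j) ≠ 0 :=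
    Finset.prod_ne_zero_iff.2 fun i _ => Finset.prod_ne_zero_iff.2 fun j _ => (hpos i j).ne'
  have hB : ∏ i : Fin (N+1), Real.Gamma (a + (κ i : ℝ) - (i : ℕ)) ≠ 0 :=
    Finset.prod_ne_zero_iff.2 fun i _ => (Real.Gamma_pos_of_pos (hbpos i)).ne'
  have hpp : π ^ ((N + 1) * (N + 1 - 1) / 2) ≠ 0 := by positivity
  simp only [cGamma, cGammaP, hG, hpi, Nat.cast_zero, add_zero]
  generalize π ^ ((N + 1) * (N + 1 - 1) / 2) = X at *
  field_simp

end
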